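/- (Characterization of the confidence set for the winner's identity.) Let X ∈ ℝ^m have a unique maximizer î = argmax_j X_j. Define Î^α = { i ∈ [m] : there exists θ ∈ ℝ^m with X ∈ A_α(θ) and θ_i = max_{j∈[m]} θ_j }, and let t_l = min{ t ∈ ℝ : |X_î − t| ≤ r_α(θ^t) } (attained), where θ^t is the worst-case vector with θ^t_î = t and θ^t_j = min{(2/3)X_j + (1/3)t, t} for j ≠ î. Then Î^α = { i ∈ [m] : X_i ≥ X_î − 2 r_α(θ^{t_l}) }. -/

import Mathlib

open Set

noncomputable section

/-- Suboptimality gap `Δ_j(θ) = max_i θ_i − θ_j`. -/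
def gapv {m : ℕ} (θ : Fin m → ℝ) (j : Fin m) : ℝ := (⨆ i, θ i) - θ j

/-- Active radius `r_α(θ) = min {r ≥ 0 : 𝐒((max{r, Δ_j(θ)/2})_j) ≤ α}`. -/
def rA {m : ℕ} (S : (Fin m → ℝ) → ℝ) (α : ℝ) (θ : Fin m → ℝ) : ℝ :=
  sInf {r : ℝ | 0 ≤ r ∧ S (fun j => max r (gapv θ j / 2)) ≤ α}

/-- Acceptance-region membership: `x ∈ A_α(θ)`. -/
def accept {m : ℕ} (S : (Fin m → ℝ) → ℝ) (α : ℝ) (θ x : Fin m → ℝ) : Prop :=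
  ∀ j, |x j - θ j| ≤ max (rA S α θ) (gapv θ j / 2)

/-- The worst-case vector `θ^t`: `θ^t_î = t`, `θ^t_j = min{(2/3)X_j + (1/3)t, t}`
for `j ≠ î`. -/
def thetaT {m : ℕ} (X : Fin m → ℝ) (ih : Fin m) (t : ℝ) : Fin m → ℝ :=
  fun j => if j = ih then t else min (2 / 3 * X j + 1 / 3 * t) t

/-- The zoom-correction confidence set `Ĉ^α_î = {t : |X_î − t| ≤ r_α(θ^t)}`. -/
def Chat {m : ℕ} (S : (Fin m → ℝ) → ℝ) (α : ℝ) (X : Fin m → ℝ) (ih : Fin m) : Set ℝ :=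
  {t : ℝ | |X ih - t| ≤ rA S α (thetaT X ih t)}

theorem S_anti_aux {m : ℕ} (S : (Fin m → ℝ) → ℝ)
    (hSanti : ∀ v : Fin m → ℝ, (∀ j, 0 ≤ v j) → ∀ (j : Fin m) (a b : ℝ),
      0 ≤ a → a < b → S (Function.update v j b) < S (Function.update v j a))
    (u v : Fin m → ℝ) (hu : ∀ j, 0 ≤ u j) (huv : ∀ j, u j ≤ v j) : S v ≤ S u := by
  have key : ∀ s : Finset (Fin m), S (s.piecewise v u) ≤ S u := by
    intro s
    induction s using Finset.induction_on with
    | empty => simp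
    | insert j s hj ih =>
      rw [Finset.piecewise_insert]
      refine le_trans ?_ ih
      have h0 : ∀ k, 0 ≤ s.piecewise v u k := by
        intro k
        by_cases hk : k ∈ s
        · simp only [hk, Finset.piecewise_eq_of_mem]; exact (hu k).trans (huv k)
        · simp only [hk, not_false_eq_true, Finset.piecewise_eq_of_notMem]; exact hu k
      have he : s.piecewise v u j = u j := by simp [hj]
      have hup : Function.update (s.piecewise v u) j (u j) = s.piecewise v u := by
        rw [← he]; exact Function.update_eq_self _ _
      rcases (huv j).lt_or_eq with h | h
      · have := hSanti _ h0 j (u j) (v j) (hu j) h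
        rw [hup] at this
        exact this.le
      · rw [← h, hup]
  simpa using key Finset.univ

theorem gapv_nonneg_aux {m : ℕ} (θ : Fin m → ℝ) (j : Fin m) : 0 ≤ gapv θ j := by
  unfold gapv
  have := le_ciSup (Set.finite_range θ).bddAbove j
  linarith

theorem gapv_of_max_aux {m : ℕ} (θ : Fin m → ℝ) (i : Fin m) (h : ∀ j, θ j ≤ θ i) (j : Fin m) :
    gapv θ j = θ i - θ j := by
  unfold gapv
  have : Nonempty (Fin m) := ⟨i⟩
  rw [le_antisymm (ciSup_le h) (le_ciSup (Set.finite_range θ).bddAbove i)]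

theorem rA_nonneg_aux {m : ℕ} (S : (Fin m → ℝ) → ℝ) (α : ℝ) (θ : Fin m → ℝ) : 0 ≤ rA S α θ :=
  Real.sInf_nonneg fun _ h => h.1

theorem rA_ne_aux {m : ℕ} (S : (Fin m → ℝ) → ℝ) (α : ℝ) (hα0 : 0 < α)
    (hSlim : ∀ ε : ℝ, 0 < ε → ∃ M : ℝ, ∀ v : Fin m → ℝ, (∀ j, M ≤ v j) → S v < ε)
    (θ : Fin m → ℝ) : {r : ℝ | 0 ≤ r ∧ S (fun j => max r (gapv θ j / 2)) ≤ α}.Nonempty := by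
  obtain ⟨M, hM⟩ := hSlim α hα0
  exact ⟨max M 0, le_max_right _ _,
    (hM _ fun j => (le_max_left _ _).trans (le_max_left _ _)).le⟩

theorem rA_le_aux {m : ℕ} (S : (Fin m → ℝ) → ℝ) (α : ℝ) (θ : Fin m → ℝ) (r : ℝ) (h0 : 0 ≤ r)
    (h : S (fun j => max r (gapv θ j / 2)) ≤ α) : rA S α θ ≤ r :=
  csInf_le ⟨0, fun _ h => h.1⟩ ⟨h0, h⟩

/-- Comparison with slack. -/
theorem rA_cmp_aux {m : ℕ} (S : (Fin m → ℝ) → ℝ) (α : ℝ) (hα0 : 0 < α)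
    (hSanti : ∀ v : Fin m → ℝ, (∀ j, 0 ≤ v j) → ∀ (j : Fin m) (a b : ℝ),
      0 ≤ a → a < b → S (Function.update v j b) < S (Function.update v j a))
    (hSlim : ∀ ε : ℝ, 0 < ε → ∃ M : ℝ, ∀ v : Fin m → ℝ, (∀ j, M ≤ v j) → S v < ε)
    (θ η : Fin m → ℝ)
    (h : ∀ j, gapv η j ≤ gapv θ j ∨ gapv η j / 2 < rA S α θ) : rA S α θ ≤ rA S α η := by
  by_contra! hlt
  obtain ⟨s, ⟨hs0, hsα⟩, hs⟩ := exists_lt_of_csInf_lt (rA_ne_aux S α hα0 hSlim η) hlt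
  have hev : ∀ᶠ r' in nhdsWithin (rA S α θ) (Set.Iio (rA S α θ)),
      s < r' ∧ r' < rA S α θ ∧ ∀ j, gapv η j / 2 < rA S α θ → gapv η j / 2 < r' := by
    have h1 : ∀ c, c < rA S α θ → ∀ᶠ r' in nhdsWithin (rA S α θ) (Set.Iio (rA S α θ)), c < r' :=
      fun c hc => Filter.Eventually.filter_mono nhdsWithin_le_nhds (lt_mem_nhds hc)
    refine (h1 s hs).and (Filter.Eventually.and self_mem_nhdsWithin ?_)
    rw [Filter.eventually_all]
    intro j
    by_cases hj : gapv η j / 2 < rA S α θ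
    · filter_upwards [h1 _ hj] with r' hr' _ using hr'
    · exact Filter.Eventually.of_forall fun _ hh => absurd hh hj
  obtain ⟨r', hsr, hr', hall⟩ := hev.exists
  have h0 : 0 ≤ r' := hs0.trans hsr.le
  refine absurd (rA_le_aux S α θ r' h0 (le_trans ?_ hsα)) (not_le.mpr hr')
  refine S_anti_aux S hSanti _ _ (fun j => hs0.trans (le_max_left _ _)) fun j => ?_
  refine max_le (hsr.le.trans (le_max_left _ _)) ?_
  rcases h j with hj | hj
  · exact le_trans (by linarith) (le_max_right _ _)
  · exact (hall j hj).le.trans (le_max_left _ _)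

theorem thetaT_gap_aux {m : ℕ} (X : Fin m → ℝ) (ih : Fin m) (t : ℝ) (j : Fin m) :
    gapv (thetaT X ih t) j = t - thetaT X ih t j := by
  have h : thetaT X ih t ih = t := by simp [thetaT]
  rw [gapv_of_max_aux _ ih, h]
  intro k
  rw [h]
  unfold thetaT
  split_ifs
  · exact le_rfl
  · exact min_le_right _ _

/-- **Characterization of the confidence set for the winner's identity.**
`Î^α = {i : ∃ θ, X ∈ A_α(θ), θ_i = max_j θ_j}` equals
`{i : X_i ≥ X_î − 2 r_α(θ^{t_l})}` where `t_l = min Ĉ^α_î`. -/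
theorem winner_identity_confidence_set
    (m : ℕ) (hm : 0 < m) (α : ℝ) (hα0 : 0 < α) (hα1 : α < 1)
    (S : (Fin m → ℝ) → ℝ)
    (hS0 : ∀ v : Fin m → ℝ, (∀ j, 0 ≤ v j) → 0 ≤ S v)
    (hScont : ContinuousOn S {v : Fin m → ℝ | ∀ j, 0 ≤ v j})
    (hSanti : ∀ v : Fin m → ℝ, (∀ j, 0 ≤ v j) → ∀ (j : Fin m) (a b : ℝ),
      0 ≤ a → a < b → S (Function.update v j b) < S (Function.update v j a))
    (hSlim : ∀ ε : ℝ, 0 < ε → ∃ M : ℝ, ∀ v : Fin m → ℝ, (∀ j, M ≤ v j) → S v < ε)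
    (X : Fin m → ℝ) (ih : Fin m) (hih : ∀ j, j ≠ ih → X j < X ih) :
    {i : Fin m | ∃ θ : Fin m → ℝ, accept S α θ X ∧ ∀ j, θ j ≤ θ i} =
    {i : Fin m | X ih - 2 * rA S α (thetaT X ih (sInf (Chat S α X ih))) ≤ X i} := by
  have hcmp := rA_cmp_aux S α hα0 hSanti hSlim
  have hmono : ∀ s t, s ≤ t → rA S α (thetaT X ih t) ≤ rA S α (thetaT X ih s) := by
    intro s t hst
    refine hcmp _ _ fun j => Or.inl ?_
    rw [thetaT_gap_aux, thetaT_gap_aux]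
    unfold thetaT
    split_ifs
    · simp
    · rcases min_cases (2 / 3 * X j + 1 / 3 * s) s with h1 | h1 <;>
      rcases min_cases (2 / 3 * X j + 1 / 3 * t) t with h2 | h2 <;> linarith [h1.1, h1.2, h2.1, h2.2]
  have hXi : ∀ j, X j ≤ X ih := by
    intro j
    by_cases h : j = ih
    · rw [h]
    · exact (hih j h).le
  have hmem : X ih ∈ Chat S α X ih := by
    simp only [Chat, Set.mem_ofPred_eq, sub_self, abs_zero]
    exact rA_nonneg_aux _ _ _
  have hbd : BddBelow (Chat S α X ih) := by
    refine ⟨X ih - rA S α (fun _ => 0), fun t ht => ?_⟩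
    have h1 : rA S α (thetaT X ih t) ≤ rA S α (fun _ => 0) := by
      refine hcmp _ _ fun j => Or.inl ?_
      rw [gapv_of_max_aux (fun _ => (0 : ℝ)) ih (fun _ => le_rfl), sub_self]
      exact gapv_nonneg_aux _ _
    have h2 := (le_abs_self _).trans (show |X ih - t| ≤ rA S α (thetaT X ih t) from ht)
    linarith
  set tl := sInf (Chat S α X ih) with htl
  set ρ := rA S α (thetaT X ih tl) with hρ
  have hρ0 : 0 ≤ ρ := rA_nonneg_aux _ _ _
  have htlX : tl ≤ X ih := csInf_le hbd hmem
  have hle : X ih - ρ ≤ tl := by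
    refine le_csInf ⟨_, hmem⟩ fun t ht => ?_
    have h1 := (le_abs_self _).trans (show |X ih - t| ≤ rA S α (thetaT X ih t) from ht)
    have h2 := hmono tl t (csInf_le hbd ht)
    linarith
  have hge : tl ≤ X ih - ρ := by
    refine csInf_le hbd ?_
    have h2 := hmono (X ih - ρ) tl hle
    simp only [Chat, Set.mem_ofPred_eq, sub_sub_cancel, abs_of_nonneg hρ0]
    exact h2
  ext i
  simp only [Set.mem_ofPred_eq]
  constructor
  · rintro ⟨θ, hacc, hmax⟩
    have hg := gapv_of_max_aux θ i hmax
    have hr0 := rA_nonneg_aux S α θ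
    have hi := hacc i
    rw [hg, sub_self, zero_div, max_eq_left hr0] at hi
    have hi' := abs_le.mp hi
    have hX : X ih ≤ θ i + rA S α θ := by
      have h1 := (le_abs_self _).trans (hacc ih)
      rw [hg] at h1
      have h2 := hmax ih
      rcases le_max_iff.mp h1 with h | h <;> linarith
    have hrM : rA S α θ ≤ rA S α (thetaT X ih (θ i)) := by
      refine hcmp _ _ fun j => ?_
      rw [thetaT_gap_aux, hg]
      have h1 := (neg_le_abs _).trans (hacc j)
      rw [hg] at h1
      have h2 := hmax j
      unfold thetaT
      split_ifs
      · left; linarith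
      · rcases min_cases (2 / 3 * X j + 1 / 3 * θ i) (θ i) with ⟨h3, h4⟩ | ⟨h3, h4⟩
        · rw [h3]
          rcases le_or_gt (rA S α θ) ((θ i - θ j) / 2) with h5 | h5
          · left
            rw [max_eq_right h5] at h1
            linarith
          · right
            rw [max_eq_left h5.le] at h1
            linarith
        · left; rw [h3]; linarith
    rcases le_or_gt tl (θ i) with h | h
    · have := hmono _ _ h
      linarith
    · exfalso
      have : tl ≤ θ i := by
        refine csInf_le hbd ?_
        simp only [Chat, Set.mem_ofPred_eq]
        rw [abs_of_nonneg (by linarith)]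
        linarith
      linarith
  · intro hi
    by_cases hii : i = ih
    · refine ⟨X, fun j => ?_, fun j => hii ▸ hXi j⟩
      rw [sub_self, abs_zero]
      exact (rA_nonneg_aux _ _ _).trans (le_max_left _ _)
    · have hTle : ∀ j, thetaT X ih tl j ≤ tl := by
        intro j
        unfold thetaT
        split_ifs
        · exact le_rfl
        · exact min_le_right _ _
      set θ := Function.update (thetaT X ih tl) i tl with hθ
      have hθi : θ i = tl := by simp [hθ]
      have hθj : ∀ j, j ≠ i → θ j = thetaT X ih tl j := by
        intro j hj
        simp [hθ, hj]
      have hmax : ∀ j, θ j ≤ θ i := by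
        intro j
        rw [hθi]
        by_cases hj : j = i
        · rw [hj, hθi]
        · rw [hθj j hj]; exact hTle j
      have hg := gapv_of_max_aux θ i hmax
      have hr : ρ ≤ rA S α θ := by
        refine hcmp _ _ fun j => Or.inl ?_
        rw [hg, thetaT_gap_aux, hθi]
        by_cases hj : j = i
        · rw [hj, hθi]; linarith [hTle i]
        · rw [hθj j hj]
      refine ⟨θ, fun j => ?_, hmax⟩
      rw [hg, hθi]
      by_cases hj : j = i
      · rw [hj, hθi]
        refine le_trans (hr.trans' ?_) (le_max_left _ _)
        rw [abs_le]
        constructor <;> linarith [hXi i]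
      · rw [hθj j hj]
        by_cases hj' : j = ih
        · have : thetaT X ih tl j = tl := by simp [thetaT, hj']
          rw [this, hj']
          refine le_trans (hr.trans' ?_) (le_max_left _ _)
          rw [abs_le]
          constructor <;> linarith
        · have : thetaT X ih tl j = min (2 / 3 * X j + 1 / 3 * tl) tl := by simp [thetaT, hj']
          rw [this]
          rcases min_cases (2 / 3 * X j + 1 / 3 * tl) tl with ⟨h3, h4⟩ | ⟨h3, h4⟩
          · rw [h3]
            refine le_trans ?_ (le_max_right _ _)
            rw [abs_le]
            constructor <;> linarith
          · rw [h3]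
            refine le_trans (hr.trans' ?_) (le_max_left _ _)
            rw [abs_le]
            constructor <;> linarith [hXi j]
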